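/- (Identity principle for λ-slice monogenic functions.) Let λ ∈ ℝ, let U ⊆ ℝ^{n+1} be an axially symmetric s-domain, let f ∈ SM_λ(U) and let I ∈ 𝕊. If the set {z ∈ U_I : e^{λ Re z} f(z) = 0} has an accumulation point in U_I, then f ≡ 0 on U. -/

import Mathlib

open scoped BigOperators
open Set

noncomputable section

/-- The sphere 𝕊 of (coefficient vectors of) unit 1-vectors in ℝⁿ. -/
def USphere (n : ℕ) : Set (Fin n → ℝ) := {x | ∑ i, x i ^ 2 = 1}

/-- Points of ℝ^{n+1}, written as (x₀, (x₁, …, xₙ)). -/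
abbrev Pt (n : ℕ) := ℝ × (Fin n → ℝ)

variable {n : ℕ} {Cl : Type} [NormedRing Cl] [NormedAlgebra ℝ Cl]

/-- The 1-vector of the Clifford algebra with coefficients `x` w.r.t. generators `e`. -/
def vecEmb (e : Fin n → Cl) (x : Fin n → ℝ) : Cl := ∑ i, x i • e i

/-- The defining relations `eᵢeⱼ + eⱼeᵢ = -2δᵢⱼ` of the Clifford algebra ℝₙ. -/
def CliffordRel (e : Fin n → Cl) : Prop :=
  ∀ i j, e i * e j + e j * e i = if i = j then (-2 : Cl) else 0

/-- The slice Cauchy–Riemann operator `(∂/∂u + I ∂/∂v)` applied to the restriction of `f`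
to the slice `ℂ_I`, `I = vecEmb e x`, evaluated at the point `u + I v`. -/
def sliceCR (e : Fin n → Cl) (f : Pt n → Cl) (x : Fin n → ℝ) (u v : ℝ) : Cl :=
  deriv (fun t => f (t, v • x)) u + vecEmb e x * deriv (fun t => f (u, t • x)) v

/-- λ-slice monogenic functions on `U`. -/
def SMlam (e : Fin n → Cl) (lam : ℝ) (U : Set (Pt n)) (f : Pt n → Cl) : Prop :=
  ContDiffOn ℝ 1 f U ∧
  ∀ x ∈ USphere n, ∀ u v : ℝ, ((u, v • x) : Pt n) ∈ U →
    sliceCR e f x u v + lam • f (u, v • x) = 0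

/-- The coordinates (u,v) of the slice `U_I = U ∩ ℂ_I`, `I = vecEmb e x`. -/
def SlicePre (n : ℕ) (U : Set (Pt n)) (x : Fin n → ℝ) : Set (ℝ × ℝ) :=
  {p | ((p.1, p.2 • x) : Pt n) ∈ U}

/-- Axially symmetric slice domains in ℝ^{n+1}. -/
def AxSymSDomain (n : ℕ) (U : Set (Pt n)) : Prop :=
  IsOpen U ∧ IsConnected U ∧ (∃ u : ℝ, ((u, (0 : Fin n → ℝ)) : Pt n) ∈ U) ∧
  (∀ x ∈ USphere n, IsConnected (SlicePre n U x)) ∧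
  ∀ x ∈ USphere n, ∀ y ∈ USphere n, ∀ u v : ℝ,
    ((u, v • x) : Pt n) ∈ U → ((u, v • y) : Pt n) ∈ U

/-- A holomorphic function with values in `ℂ_I`, `I = vecEmb e x`, on a
(relatively open) coordinate set `V`. -/
def SliceHolo (e : Fin n → Cl) (x : Fin n → ℝ) (V : Set (ℝ × ℝ)) (F : ℝ × ℝ → Cl) : Prop :=
  DifferentiableOn ℝ F V ∧
  (∀ p ∈ V, ∃ a b : ℝ, F p = algebraMap ℝ Cl a + b • vecEmb e x) ∧
  ∀ p ∈ V, deriv (fun t => F (t, p.2)) p.1 + vecEmb e x * deriv (fun t => F (p.1, t)) p.2 = 0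

/-- Ordered product `I_A = I_{i₁} ⋯ I_{i_k}` over a finite index set `A`. -/
def IAprod (e : Fin n → Cl) (J : Fin n → Fin n → ℝ) (A : Finset (Fin n)) : Cl :=
  ((A.sort (· ≤ ·)).map fun i => vecEmb e (J i)).prod

/-- A closed piecewise-C¹ curve parametrized on [0,1]. -/
def PiecewiseC1 (γ : ℝ → ℝ × ℝ) : Prop :=
  ContinuousOn γ (Icc 0 1) ∧
  ∃ (k : ℕ) (t : Fin (k + 1) → ℝ), t 0 = 0 ∧ t (Fin.last k) = 1 ∧ StrictMono t ∧
    ∀ i : Fin k, ContDiffOn ℝ 1 γ (Icc (t i.castSucc) (t i.succ))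

/-- `γ` is a closed curve in `V`, homotopic within `V` to a constant curve. -/
def NullHomotopicIn (γ : ℝ → ℝ × ℝ) (V : Set (ℝ × ℝ)) : Prop :=
  γ 0 = γ 1 ∧ (∀ t ∈ Icc (0:ℝ) 1, γ t ∈ V) ∧
  ∃ (H : ℝ × ℝ → ℝ × ℝ) (p : ℝ × ℝ),
    ContinuousOn H (Icc 0 1 ×ˢ Icc 0 1) ∧
    (∀ q ∈ (Icc (0:ℝ) 1 ×ˢ Icc (0:ℝ) 1), H q ∈ V) ∧
    (∀ t ∈ Icc (0:ℝ) 1, H (0, t) = γ t) ∧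
    (∀ t ∈ Icc (0:ℝ) 1, H (1, t) = p) ∧
    (∀ s ∈ Icc (0:ℝ) 1, H (s, 0) = H (s, 1))

/-- The inverse `(a + bI)⁻¹` computed in the field `ℂ_I`, `I = vecEmb e x`. -/
def sliceInv (e : Fin n → Cl) (x : Fin n → ℝ) (a b : ℝ) : Cl :=
  (a ^ 2 + b ^ 2)⁻¹ • (algebraMap ℝ Cl a - b • vecEmb e x)

/-- The closed Euclidean ball of ℝ^{n+1}. -/
def EucClosedBall (y : Pt n) (ρ : ℝ) : Set (Pt n) :=
  {p | (p.1 - y.1) ^ 2 + ∑ i, (p.2 i - y.2 i) ^ 2 ≤ ρ ^ 2}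

/-- Left fractional integral of order `σ` with respect to `g` (with derivative `g'`),
with base point `aa`. -/
def fracInt (aa σ : ℝ) (g g' : ℝ → ℝ) (φ : ℝ → Cl) (u : ℝ) : Cl :=
  (Real.Gamma σ)⁻¹ • ∫ τ in aa..u, ((g u - g τ) ^ (σ - 1) * g' τ) • φ τ

/-- Right fractional integral of order `σ` with respect to `h` (with derivative `h'`),
with base point `cc`. -/
def fracIntR (cc σ : ℝ) (h h' : ℝ → ℝ) (φ : ℝ → Cl) (v : ℝ) : Cl :=
  (Real.Gamma σ)⁻¹ • ∫ τ in v..cc, ((h τ - h v) ^ (σ - 1) * h' τ) • φ τ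

/-- Left Riemann–Liouville fractional derivative of order `al` w.r.t. `g` on `[aa, bb]`
(one-sided derivatives at the endpoints). -/
def rlD (aa bb al : ℝ) (g g' : ℝ → ℝ) (φ : ℝ → Cl) (u : ℝ) : Cl :=
  (g' u)⁻¹ • derivWithin (fracInt aa (1 - al) g g' φ) (Icc aa bb) u

/-- The set `S_{a,b,c} ⊆ ℝ^{n+1}`. -/
def Sabc (n : ℕ) (a b c : ℝ) : Set (Pt n) :=
  {p | ∃ x ∈ USphere n, ∃ u ∈ Icc a b, ∃ v ∈ Icc 0 c, p = ((u, v • x) : Pt n)}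

/-- Absolutely continuous function on `[a,b]`. -/
def AbsContOn {E : Type} [NormedAddCommGroup E] (φ : ℝ → E) (a b : ℝ) : Prop :=
  ∀ ε > (0:ℝ), ∃ δ > (0:ℝ), ∀ (k : ℕ) (p q : Fin k → ℝ),
    (∀ i, p i ∈ Icc a b ∧ q i ∈ Icc a b ∧ p i ≤ q i) →
    (∀ i j, i ≠ j → Ioo (p i) (q i) ∩ Ioo (p j) (q j) = ∅) →
    (∑ i, (q i - p i)) < δ → (∑ i, ‖φ (q i) - φ (p i)‖) < ε

/-- The class `AC¹(S_{a,b,c}, ℝₙ)`. -/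
def AC1 (a b c r s : ℝ) (f : Pt n → Cl) : Prop :=
  ContinuousOn f (Sabc n a b c) ∧
  ∀ x ∈ USphere n,
    AbsContOn (fun u => f (u, s • x)) a b ∧ AbsContOn (fun v => f (r, v • x)) 0 c

/-- `A_I(u) = (I_{a+}^{1-α,g}[τ ↦ f(τ + Is)])(u)`, where `I = vecEmb e x`. -/
def AIfun (a al s : ℝ) (g g' : ℝ → ℝ) (f : Pt n → Cl) (x : Fin n → ℝ) : ℝ → Cl :=
  fracInt a (1 - al) g g' fun τ => f (τ, s • x)

/-- `B_I(v) = (I_{0+}^{1-β,h}[τ ↦ f(r + Iτ)])(v)`, where `I = vecEmb e x`. -/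
def BIfun (be r : ℝ) (h h' : ℝ → ℝ) (f : Pt n → Cl) (x : Fin n → ℝ) : ℝ → Cl :=
  fracInt 0 (1 - be) h h' fun τ => f (r, τ • x)

/-- `B_I^{c-}(v) = (I_{c-}^{1-β,h}[τ ↦ f(r + Iτ)])(v)`, where `I = vecEmb e x`. -/
def BIcfun (c be r : ℝ) (h h' : ℝ → ℝ) (f : Pt n → Cl) (x : Fin n → ℝ) : ℝ → Cl :=
  fracIntR c (1 - be) h h' fun τ => f (r, τ • x)

/-- Condition (m1): the maps `A_I` and `B_I` are of class C¹ for every `I ∈ 𝕊`. -/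
def M1 (a b c al be r s : ℝ) (g g' h h' : ℝ → ℝ) (f : Pt n → Cl) : Prop :=
  ∀ x ∈ USphere n,
    ContDiffOn ℝ 1 (AIfun a al s g g' f x) (Icc a b) ∧
    ContDiffOn ℝ 1 (BIfun be r h h' f x) (Icc 0 c)

/-- Riemann–Liouville fractional slice monogenic functions of order `(α,β)`
with respect to `(g,h)` on `S_{a,b,c}`. -/
def RLSM (a b c al be r s : ℝ) (g g' h h' : ℝ → ℝ) (e : Fin n → Cl) (f : Pt n → Cl) : Prop :=
  AC1 a b c r s f ∧ M1 a b c al be r s g g' h h' f ∧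
  ∀ x ∈ USphere n, ∀ u ∈ Icc a b, ∀ v ∈ Icc 0 c,
    (g' u)⁻¹ • derivWithin (AIfun a al s g g' f x) (Icc a b) u +
      vecEmb e x * ((h' v)⁻¹ • derivWithin (BIfun be r h h' f x) (Icc 0 c) v) = 0


theorem vecEmb_mul_self {e : Fin n → Cl} (he : CliffordRel e) {x : Fin n → ℝ}
    (hx : x ∈ USphere n) : vecEmb e x * vecEmb e x = -1 := by
  have hsq : vecEmb e x * vecEmb e x = ∑ i, ∑ j, (x i * x j) • (e i * e j) := by
    simp only [vecEmb, Finset.sum_mul_sum, smul_mul_smul_comm]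
  have hsq' : vecEmb e x * vecEmb e x = ∑ i, ∑ j, (x i * x j) • (e j * e i) := by
    rw [hsq, Finset.sum_comm]
    simp only [mul_comm]
  have hdouble : (2 : ℝ) • (vecEmb e x * vecEmb e x) = (2 : ℝ) • (-1 : Cl) := by
    calc (2 : ℝ) • (vecEmb e x * vecEmb e x)
        = ∑ i, ∑ j, (x i * x j) • (e i * e j + e j * e i) := by
          rw [two_smul]
          nth_rewrite 1 [hsq]
          rw [hsq']
          simp only [smul_add, Finset.sum_add_distrib]
      _ = ∑ i, (x i ^ 2) • (-2 : Cl) := by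
          refine Finset.sum_congr rfl fun i _ => ?_
          rw [Finset.sum_eq_single i]
          · rw [he, if_pos rfl, sq]
          · intro j _ hj
            rw [he, if_neg hj.symm, smul_zero]
          · simp
      _ = (2 : ℝ) • (-1 : Cl) := by
          rw [← Finset.sum_smul, show ∑ i, x i ^ 2 = 1 from hx, one_smul, two_smul]
          norm_num
  exact smul_right_injective Cl (two_ne_zero : (2 : ℝ) ≠ 0) hdouble

/-- The inclusion of `ℂ`, identified with the slice in direction `x`, into `ℝ^{n+1}`. -/
def sliceCLM (x : Fin n → ℝ) : ℂ →L[ℝ] Pt n :=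
  Complex.reCLM.prod (Complex.imCLM.smulRight x)

@[simp]
theorem sliceCLM_apply (x : Fin n → ℝ) (z : ℂ) : sliceCLM x z = (z.re, z.im • x) := rfl

/-- A real functional `φ`, complexified so that left multiplication by a square root `J`
of `-1` becomes multiplication by `i`. -/
def complexifyFunctional (J : Cl) (φ : Cl →L[ℝ] ℝ) : Cl →L[ℝ] ℂ :=
  Complex.ofRealCLM ∘L φ -
    Complex.I • (Complex.ofRealCLM ∘L φ ∘L ContinuousLinearMap.mul ℝ Cl J)

theorem complexifyFunctional_apply (J : Cl) (φ : Cl →L[ℝ] ℝ) (a : Cl) :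
    complexifyFunctional J φ a = φ a - Complex.I * φ (J * a) := rfl

theorem complexifyFunctional_mul {J : Cl} (hJ : J * J = -1) (φ : Cl →L[ℝ] ℝ) (a : Cl) :
    complexifyFunctional J φ (J * a) = Complex.I * complexifyFunctional J φ a := by
  simp only [complexifyFunctional_apply, ← mul_assoc, hJ, neg_mul, one_mul, map_neg,
    Complex.ofReal_neg, mul_sub, Complex.I_mul_I]
  ring

/-- On a slice, `e^{λ Re z} f(z)` becomes holomorphic after applying a complexified functional. -/
theorem SMlam.differentiableAt_slice {e : Fin n → Cl} (he : CliffordRel e) {lam : ℝ}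
    {U : Set (Pt n)} (hU : IsOpen U) {f : Pt n → Cl} (hf : SMlam e lam U f)
    {x : Fin n → ℝ} (hx : x ∈ USphere n) (φ : Cl →L[ℝ] ℝ) {z : ℂ} (hz : sliceCLM x z ∈ U) :
    DifferentiableAt ℂ (fun w => complexifyFunctional (vecEmb e x) φ
      (Real.exp (lam * w.re) • f (sliceCLM x w))) z := by
  set J := vecEmb e x
  have hJ : J * J = -1 := vecEmb_mul_self he hx
  obtain ⟨M, hM⟩ : DifferentiableAt ℝ f (sliceCLM x z) :=
    (hf.1.differentiableOn one_ne_zero).differentiableAt (hU.mem_nhds hz)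
  have hu : deriv (fun t => f (t, z.im • x)) z.re = M (1, 0) :=
    (hM.comp_hasDerivAt z.re ((hasDerivAt_id z.re).prodMk (hasDerivAt_const z.re (z.im • x)))).deriv
  have hv : deriv (fun t => f (z.re, t • x)) z.im = M (0, x) := by
    have hline : HasDerivAt (fun t : ℝ => ((z.re, t • x) : Pt n)) (0, x) z.im := by
      simpa using (hasDerivAt_const z.im z.re).prodMk ((hasDerivAt_id z.im).smul_const x)
    exact (hM.comp_hasDerivAt z.im hline).deriv
  have hCR : M (1, 0) + J * M (0, x) + lam • f (sliceCLM x z) = 0 := by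
    have := hf.2 x hx z.re z.im hz
    rwa [sliceCR, hu, hv] at this
  have hexp : HasFDerivAt (fun w : ℂ => Real.exp (lam * w.re))
      (Real.exp (lam * z.re) • (lam • Complex.reCLM)) z :=
    (Complex.reCLM.hasFDerivAt.const_mul lam).exp
  have hF := (complexifyFunctional J φ).hasFDerivAt.comp z
    (hexp.smul (hM.comp z (sliceCLM x).hasFDerivAt))
  refine differentiableAt_complex_iff_differentiableAt_real.2 ⟨hF.differentiableAt, ?_⟩
  have hMx : M (0, x) = J * (M (1, 0) + lam • f (sliceCLM x z)) := by
    have hsum : M (1, 0) + lam • f (sliceCLM x z) = -(J * M (0, x)) := by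
      rw [eq_neg_iff_add_eq_zero, ← hCR]
      abel
    rw [hsum, mul_neg, ← mul_assoc, hJ, neg_mul, one_mul, neg_neg]
  change fderiv ℝ (_ ∘ ((fun w : ℂ => Real.exp (lam * w.re)) • (f ∘ sliceCLM x))) z Complex.I =
    Complex.I • fderiv ℝ (_ ∘ ((fun w : ℂ => Real.exp (lam * w.re)) • (f ∘ sliceCLM x))) z 1
  rw [hF.fderiv]
  simp [hMx, complexifyFunctional_mul hJ, smul_smul]
  ring

open Topology in
theorem SMlam.eq_zero_on_slice {e : Fin n → Cl} (he : CliffordRel e) {lam : ℝ}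
    {U : Set (Pt n)} (hU : IsOpen U) {f : Pt n → Cl} (hf : SMlam e lam U f)
    {x : Fin n → ℝ} (hx : x ∈ USphere n) (hconn : IsPreconnected (sliceCLM x ⁻¹' U))
    {z₀ : ℂ} (hz₀ : sliceCLM x z₀ ∈ U)
    (hfreq : ∃ᶠ z in 𝓝[≠] z₀, f (sliceCLM x z) = 0) {z : ℂ} (hz : sliceCLM x z ∈ U) :
    f (sliceCLM x z) = 0 := by
  refine SeparatingDual.eq_zero_of_forall_dual_eq_zero (R := ℝ) fun φ => ?_
  have hopen : IsOpen (sliceCLM x ⁻¹' U) := hU.preimage (sliceCLM x).continuous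
  have han : AnalyticOnNhd ℂ _ (sliceCLM x ⁻¹' U) := DifferentiableOn.analyticOnNhd
    (fun w hw => (hf.differentiableAt_slice he hU hx φ hw).differentiableWithinAt) hopen
  have hzero := han.eqOn_zero_of_preconnected_of_frequently_eq_zero hconn hz₀
    (hfreq.mono fun w hw => by rw [hw, smul_zero, map_zero]) hz
  have hre : φ (Real.exp (lam * z.re) • f (sliceCLM x z)) = 0 := by
    simpa [complexifyFunctional_apply, -sliceCLM_apply, -Complex.ofReal_exp, -map_smul] using
      congrArg Complex.re hzero
  rw [map_smul, smul_eq_zero] at hre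
  exact hre.resolve_left (Real.exp_pos _).ne'

theorem isPreconnected_preimage_sliceCLM {U : Set (Pt n)} {x : Fin n → ℝ}
    (h : IsPreconnected (SlicePre n U x)) : IsPreconnected (sliceCLM x ⁻¹' U) := by
  have := h.image _ Complex.equivRealProdCLM.symm.continuous.continuousOn
  rwa [ContinuousLinearEquiv.image_symm_eq_preimage] at this

theorem exists_mem_USphere_smul {x : Fin n → ℝ} (hx : x ∈ USphere n) (w : Fin n → ℝ) :
    ∃ y ∈ USphere n, ∃ v : ℝ, w = v • y := by
  by_cases hw : w = 0
  · exact ⟨x, hx, 0, by simp [hw]⟩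
  have hnonneg : 0 ≤ ∑ i, w i ^ 2 := Finset.sum_nonneg fun i _ => sq_nonneg _
  have hne : ∑ i, w i ^ 2 ≠ 0 := fun h => hw <| funext fun i =>
    pow_eq_zero_iff two_ne_zero |>.1
      ((Finset.sum_eq_zero_iff_of_nonneg fun i _ => sq_nonneg (w i)).1 h i (Finset.mem_univ i))
  have hsqrt : √(∑ i, w i ^ 2) ≠ 0 := (Real.sqrt_ne_zero hnonneg).2 hne
  refine ⟨(√(∑ i, w i ^ 2))⁻¹ • w, ?_, √(∑ i, w i ^ 2), (smul_inv_smul₀ hsqrt w).symm⟩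
  simp only [USphere, mem_ofPred_eq, Pi.smul_apply, smul_eq_mul, mul_pow, ← Finset.mul_sum,
    inv_pow, Real.sq_sqrt hnonneg]
  exact inv_mul_cancel₀ hne

open Filter Topology in
/-- Identity principle for λ-slice monogenic functions. -/
theorem statement6 (e : Fin n → Cl) (he : CliffordRel e) (lam : ℝ)
    (U : Set (Pt n)) (hU : AxSymSDomain n U) (f : Pt n → Cl) (hf : SMlam e lam U f)
    (x : Fin n → ℝ) (hx : x ∈ USphere n)
    (hacc : ∃ p ∈ SlicePre n U x, AccPt p (Filter.principal
      {q ∈ SlicePre n U x | Real.exp (lam * q.1) • f (q.1, q.2 • x) = 0})) :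
    ∀ p ∈ U, f p = 0 := by
  obtain ⟨hopen, -, ⟨u₀, hu₀⟩, hconn, -⟩ := hU
  obtain ⟨p, hp, hacc⟩ := hacc
  have hslice : ∀ z : ℂ, sliceCLM x z ∈ U → f (sliceCLM x z) = 0 := by
    refine fun z => hf.eq_zero_on_slice he hopen hx
      (isPreconnected_preimage_sliceCLM (hconn x hx).isPreconnected)
      (z₀ := Complex.equivRealProdCLM.symm p) hp ?_
    rw [accPt_iff_frequently_nhdsNE] at hacc
    have htend : Tendsto Complex.equivRealProdCLM.symm (𝓝[≠] p)
        (𝓝[≠] Complex.equivRealProdCLM.symm p) :=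
      Complex.equivRealProdCLM.symm.continuous.continuousWithinAt.tendsto_nhdsWithin
        fun _ hq => Complex.equivRealProdCLM.symm.injective.ne hq
    refine htend.frequently (hacc.mono fun q hq => ?_)
    exact (smul_eq_zero.1 hq.2).resolve_left (Real.exp_pos _).ne'
  have hreal : ∀ y : Fin n → ℝ, ∃ᶠ z in 𝓝[≠] (u₀ : ℂ), f (sliceCLM y z) = 0 := by
    intro y
    have htend : Tendsto (fun t : ℝ => (t : ℂ)) (𝓝[≠] u₀) (𝓝[≠] (u₀ : ℂ)) :=
      Complex.continuous_ofReal.continuousWithinAt.tendsto_nhdsWithin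
        fun _ ht => Complex.ofReal_injective.ne ht
    refine htend.frequently (Eventually.frequently ?_)
    have hmem : ∀ᶠ t : ℝ in 𝓝 u₀, ((t, 0) : Pt n) ∈ U :=
      (Continuous.prodMk_left (0 : Fin n → ℝ)).continuousAt.eventually_mem
        (hopen.mem_nhds hu₀)
    filter_upwards [hmem.filter_mono nhdsWithin_le_nhds] with t ht
    simpa using hslice t (by simpa using ht)
  rintro ⟨u, w⟩ hp'
  obtain ⟨y, hy, v, rfl⟩ := exists_mem_USphere_smul hx w
  exact hf.eq_zero_on_slice he hopen hy
    (isPreconnected_preimage_sliceCLM (hconn y hy).isPreconnected)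
    (z₀ := u₀) (by simpa using hu₀) (hreal y) (z := ⟨u, v⟩) hp'
end
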